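/- Let Δ_γ, Δ_α, Δ_β be bounded closed intervals in ℝ with Δ_γ ∩ Δ_α = ∅ and Δ_β ∩ Δ_α = ∅, and let σ_γ ∈ M(Δ_γ), σ_α ∈ M(Δ_α), σ_β ∈ M(Δ_β). Let τ_{α,β} ∈ M(Δ_α) be the inverse measure of ⟨σ_α, σ_β⟩ and τ_{α,β;γ,γ} ∈ M(Δ_α) the inverse measure of ⟨⟨σ_α, σ_β⟩, σ_γ⟩. Then for every z ∈ ℂ ∖ Δ_α: (⟨σ_α,σ_β⟩^(z)/⟨⟨σ_α,σ_β⟩,σ_γ⟩^(z)) · ⟨(⟨σ_β,σ_α⟩^/σ̂_β)·τ_{α,β}, σ_γ, σ_α, σ_β⟩^(z) = Ĥ(z), where H is the measure with density x ↦ (⟨σ_β,σ_α,σ_γ⟩^(x)/σ̂_β(x)) · (⟨σ_γ,σ_α,σ_β⟩^(x)/σ̂_γ(x)) with respect to τ_{α,β;γ,γ}, and (⟨σ_β,σ_α⟩^/σ̂_β)·τ_{α,β} denotes the measure with density x ↦ ⟨σ_β,σ_α⟩^(x)/σ̂_β(x) with respect to τ_{α,β}. -/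

import Mathlib

open MeasureTheory Set Polynomial Filter

noncomputable section

/-- A signed Borel measure on `ℝ`, represented by a pair of (nonnegative) measures
(a "positive part" and a "negative part"). -/
structure SignedM where
  pos : MeasureTheory.Measure ℝ
  neg : MeasureTheory.Measure ℝ

namespace SignedM

/-- Integral of a complex-valued function against a signed measure. -/
def cintegral (s : SignedM) (f : ℝ → ℂ) : ℂ :=
  (∫ x, f x ∂s.pos) - ∫ x, f x ∂s.neg

/-- Integral of a real-valued function against a signed measure. -/
def rintegral (s : SignedM) (f : ℝ → ℝ) : ℝ :=
  (∫ x, f x ∂s.pos) - ∫ x, f x ∂s.neg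

/-- The Cauchy transform `ŝ(z) = ∫ ds(x)/(z - x)` at a complex point. -/
def cauchy (s : SignedM) (z : ℂ) : ℂ :=
  s.cintegral fun x => (z - (x : ℂ))⁻¹

/-- The Cauchy transform at a real point (real-valued). -/
def cauchyR (s : SignedM) (x : ℝ) : ℝ :=
  s.rintegral fun t => (x - t)⁻¹

/-- The total variation `|s|` (for the constant-sign representation used here). -/
def mass (s : SignedM) : ℝ :=
  (s.pos Set.univ).toReal + (s.neg Set.univ).toReal

/-- The (topological) support of a nonnegative measure. -/
def msupport (μ : MeasureTheory.Measure ℝ) : Set ℝ :=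
  {x | ∀ U : Set ℝ, IsOpen U → x ∈ U → μ U ≠ 0}

/-- The support of a signed measure. -/
def supp (s : SignedM) : Set ℝ := msupport s.pos ∪ msupport s.neg

/-- The signed measure `g·s` with (real, possibly sign-changing) density `g` w.r.t. `s`. -/
def withDensityR (s : SignedM) (g : ℝ → ℝ) : SignedM where
  pos := s.pos.withDensity (fun x => ENNReal.ofReal (g x)) +
    s.neg.withDensity (fun x => ENNReal.ofReal (-g x))
  neg := s.pos.withDensity (fun x => ENNReal.ofReal (-g x)) +
    s.neg.withDensity (fun x => ENNReal.ofReal (g x))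

/-- The product `⟨a, b⟩`: the measure with density `b̂` with respect to `a`. -/
def nik (a b : SignedM) : SignedM := a.withDensityR b.cauchyR

end SignedM

/-- `s ∈ M(Δ)`: a finite Borel measure with constant sign, whose support is compact and
consists of infinitely many points, `Δ` being the smallest closed interval containing it. -/
structure IsM (s : SignedM) (Δ : Set ℝ) : Prop where
  posFinite : MeasureTheory.IsFiniteMeasure s.pos
  negFinite : MeasureTheory.IsFiniteMeasure s.neg
  constSign : s.pos = 0 ∨ s.neg = 0
  compactSupp : IsCompact s.supp
  infiniteSupp : s.supp.Infinite
  hullEq : Δ = Set.Icc (sInf s.supp) (sSup s.supp)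

/-- A set of reals, viewed inside `ℂ`. -/
def cSet (Δ : Set ℝ) : Set ℂ := (fun x : ℝ => (x : ℂ)) '' Δ

/-- `τ` is the inverse measure of `s`: `1/ŝ(z) = z/|s| + b + τ̂(z)` on `ℂ ∖ Δ`. -/
def IsInverse (s τ : SignedM) (Δ : Set ℝ) : Prop :=
  ∃ b : ℝ, ∀ z : ℂ, z ∉ cSet Δ →
    (s.cauchy z)⁻¹ = z / (s.mass : ℂ) + (b : ℂ) + τ.cauchy z

/-- The iterated products `s_{j,k} = ⟨σ_j, σ_{j+1}, …, σ_k⟩` of a Nikishin system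
(`s_{j,k} = σ_j` when `j ≥ k`). -/
def nikSys (σ : ℕ → SignedM) : ℕ → ℕ → SignedM
  | j, k => if h : j < k then (σ j).nik (nikSys σ (j + 1) k) else σ j
  termination_by j k => k - j
  decreasing_by omega

/-- A finite measure which does not charge the complement of `K`. -/
structure ConcentratedOn (μ : Measure ℝ) (K : Set ℝ) : Prop where
  finite : IsFiniteMeasure μ
  compl_eq_zero : μ Kᶜ = 0

namespace ConcentratedOn

variable {μ ν : Measure ℝ} {K : Set ℝ}

lemma mono {L : Set ℝ} (hμ : ConcentratedOn μ K) (h : K ⊆ L) : ConcentratedOn μ L :=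
  ⟨hμ.finite, measure_mono_null (compl_subset_compl.2 h) hμ.compl_eq_zero⟩

lemma ae_mem (hμ : ConcentratedOn μ K) : ∀ᵐ x ∂μ, x ∈ K :=
  measure_eq_zero_iff_ae_notMem.1 hμ.compl_eq_zero |>.mono fun _ hx => not_not.1 hx

lemma restrict_eq (hμ : ConcentratedOn μ K) : μ.restrict K = μ :=
  Measure.restrict_eq_self_of_ae_mem hμ.ae_mem

lemma integrable {E : Type*} [NormedAddCommGroup E] (hμ : ConcentratedOn μ K)
    (hK : IsCompact K) {f : ℝ → E} (hf : ContinuousOn f K) : Integrable f μ := by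
  have := hμ.finite
  have h := hf.integrableOn_compact (μ := μ) hK
  rwa [IntegrableOn, hμ.restrict_eq] at h

lemma integral_congr {E : Type*} [NormedAddCommGroup E] [NormedSpace ℝ E]
    (hμ : ConcentratedOn μ K) {f g : ℝ → E} (hfg : EqOn f g K) :
    ∫ x, f x ∂μ = ∫ x, g x ∂μ :=
  integral_congr_ae (hμ.ae_mem.mono fun _ hx => hfg hx)

lemma add (hμ : ConcentratedOn μ K) (hν : ConcentratedOn ν K) : ConcentratedOn (μ + ν) K :=
  have := hμ.finite
  have := hν.finite
  ⟨inferInstance, by simp [hμ.compl_eq_zero, hν.compl_eq_zero]⟩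

lemma withDensity (hμ : ConcentratedOn μ K) (hK : IsCompact K) {g : ℝ → ℝ}
    (hg : ContinuousOn g K) : ConcentratedOn (μ.withDensity fun x => ENNReal.ofReal (g x)) K :=
  ⟨isFiniteMeasure_withDensity_ofReal (hμ.integrable hK hg).2,
    withDensity_absolutelyContinuous _ _ hμ.compl_eq_zero⟩

lemma integral_withDensity (hμ : ConcentratedOn μ K) (hK : IsCompact K) {g : ℝ → ℝ}
    (hg : ContinuousOn g K) (f : ℝ → ℂ) :
    ∫ x, f x ∂(μ.withDensity fun x => ENNReal.ofReal (g x)) =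
      ∫ x, ((max (g x) 0 : ℝ) : ℂ) * f x ∂μ := by
  have h : AEMeasurable g μ := by
    have := hg.aemeasurable (μ := μ) hK.measurableSet
    rwa [hμ.restrict_eq] at this
  rw [integral_withDensity_eq_integral_toReal_smul₀ h.ennreal_ofReal (by simp)]
  simp [ENNReal.toReal_ofReal']

lemma integral_withDensity_sub (hμ : ConcentratedOn μ K) (hK : IsCompact K) {g : ℝ → ℝ}
    (hg : ContinuousOn g K) {f : ℝ → ℂ} (hf : ContinuousOn f K) :
    ∫ x, f x ∂(μ.withDensity fun x => ENNReal.ofReal (g x)) -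
        ∫ x, f x ∂(μ.withDensity fun x => ENNReal.ofReal (-g x)) =
      ∫ x, (g x : ℂ) * f x ∂μ := by
  rw [hμ.integral_withDensity hK hg, hμ.integral_withDensity hK (g := fun x => -g x) hg.neg, ← integral_sub]
  · refine integral_congr_ae (.of_forall fun x => ?_)
    simp only [← sub_mul, ← Complex.ofReal_sub]
    rcases le_total 0 (g x) with h | h
    · simp [h]
    · simp [h]
  · exact hμ.integrable hK (by fun_prop)
  · exact hμ.integrable hK (by fun_prop)

lemma integral_swap {L : Set ℝ} (hμ : ConcentratedOn μ K) (hν : ConcentratedOn ν L)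
    (hK : IsCompact K) (hL : IsCompact L) {F : ℝ → ℝ → ℂ}
    (hF : ContinuousOn (Function.uncurry F) (K ×ˢ L)) :
    ∫ x, ∫ t, F x t ∂ν ∂μ = ∫ t, ∫ x, F x t ∂μ ∂ν := by
  have := hμ.finite
  have := hν.finite
  apply integral_integral_swap
  have h := hF.integrableOn_compact (μ := μ.prod ν) (hK.prod hL)
  rwa [IntegrableOn, ← Measure.prod_restrict, hμ.restrict_eq, hν.restrict_eq] at h

lemma integral_ne_zero (hμ : ConcentratedOn μ K) (hK : IsCompact K) (hK' : IsPreconnected K)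
    (h0 : μ ≠ 0) {f : ℝ → ℝ} (hf : ContinuousOn f K) (hne : ∀ x ∈ K, f x ≠ 0) :
    ∫ x, f x ∂μ ≠ 0 := by
  have key : ∀ f : ℝ → ℝ, ContinuousOn f K → (∀ x ∈ K, 0 < f x) → 0 < ∫ x, f x ∂μ := by
    intro f hf hpos
    rw [integral_pos_iff_support_of_nonneg_ae (hμ.ae_mem.mono fun x hx => (hpos x hx).le)
      (hμ.integrable hK hf), pos_iff_ne_zero]
    intro h
    apply h0
    rw [← Measure.measure_univ_eq_zero, ← union_compl_self K]
    exact measure_union_null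
      (measure_mono_null (fun x hx => (hpos x hx).ne') h) hμ.compl_eq_zero
  by_cases hp : ∀ x ∈ K, 0 < f x
  · exact (key f hf hp).ne'
  · push Not at hp
    obtain ⟨a, ha, hfa⟩ := hp
    have hn : ∀ x ∈ K, 0 < -f x := by
      intro x hx
      by_contra! hc
      obtain ⟨y, hy, hy0⟩ := hK'.intermediate_value ha hx hf ⟨hfa, by linarith⟩
      exact hne y hy hy0
    have := key _ hf.neg hn
    simp only [Pi.neg_apply, integral_neg] at this
    linarith

end ConcentratedOn

lemma mem_cSet_ofReal {K : Set ℝ} {x : ℝ} : (x : ℂ) ∈ cSet K ↔ x ∈ K := by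
  simp [cSet]

lemma cSet_mono {K L : Set ℝ} (h : K ⊆ L) : cSet K ⊆ cSet L := image_mono h

lemma isOpen_compl_cSet {K : Set ℝ} (hK : IsCompact K) : IsOpen (cSet K)ᶜ :=
  (hK.image Complex.continuous_ofReal).isClosed.isOpen_compl

lemma sub_ofReal_ne_zero {K : Set ℝ} {z : ℂ} (hz : z ∉ cSet K) {x : ℝ} (hx : x ∈ K) :
    z - (x : ℂ) ≠ 0 := fun h => hz ⟨x, hx, (sub_eq_zero.1 h).symm⟩

lemma continuousOn_inv_sub {K : Set ℝ} {z : ℂ} (hz : z ∉ cSet K) :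
    ContinuousOn (fun x : ℝ => (z - (x : ℂ))⁻¹) K :=
  ContinuousOn.inv₀ (by fun_prop) fun _ hx => sub_ofReal_ne_zero hz hx

lemma ConcentratedOn.differentiableOn_integral {μ : Measure ℝ} {K : Set ℝ}
    (hμ : ConcentratedOn μ K) (hK : IsCompact K) :
    DifferentiableOn ℂ (fun z : ℂ => ∫ x, (z - (x : ℂ))⁻¹ ∂μ) (cSet K)ᶜ := by
  intro z₀ hz₀
  have := hμ.finite
  obtain ⟨ε, hε, hball⟩ := Metric.isOpen_iff.1 (isOpen_compl_cSet hK) z₀ hz₀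
  have hsub : Metric.ball z₀ (ε / 2) ⊆ Metric.ball z₀ ε := Metric.ball_subset_ball (by linarith)
  have hmeas : ∀ z ∈ Metric.ball z₀ (ε / 2), Integrable (fun x : ℝ => (z - (x : ℂ))⁻¹) μ :=
    fun z hz => hμ.integrable hK (continuousOn_inv_sub (hball (hsub hz)))
  have hnhds : Metric.ball z₀ (ε / 2) ∈ nhds z₀ := Metric.ball_mem_nhds _ (by linarith)
  refine (hasDerivAt_integral_of_dominated_loc_of_deriv_le (F := fun (z : ℂ) (x : ℝ) =>
    (z - (x : ℂ))⁻¹) (F' := fun (z : ℂ) (x : ℝ) => -1 / (z - (x : ℂ)) ^ 2)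
    (bound := fun _ => 1 / (ε / 2) ^ 2) hnhds ?_ (hmeas z₀ (mem_of_mem_nhds hnhds)) ?_ ?_
    (integrable_const _) ?_).2.differentiableAt.differentiableWithinAt
  · filter_upwards [hnhds] with z hz using (hmeas z hz).aestronglyMeasurable
  · refine (hμ.integrable hK (ContinuousOn.div (by fun_prop) (by fun_prop) ?_)).aestronglyMeasurable
    exact fun x hx => pow_ne_zero _ (sub_ofReal_ne_zero hz₀ hx)
  · filter_upwards [hμ.ae_mem] with x hx z hz
    have h1 : ε ≤ dist (x : ℂ) z₀ := by
      by_contra! h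
      exact hball (Metric.mem_ball.2 h) (mem_cSet_ofReal.2 hx)
    have h2 : ε / 2 ≤ ‖z - (x : ℂ)‖ := by
      have h3 := dist_triangle_right (x : ℂ) z₀ z
      rw [Metric.mem_ball, dist_comm] at hz
      rw [← dist_eq_norm, dist_comm]
      linarith
    rw [norm_div, norm_pow, norm_neg, norm_one]
    gcongr
  · filter_upwards [hμ.ae_mem] with x hx z hz
    exact ((hasDerivAt_id z).sub_const (x : ℂ)).inv (sub_ofReal_ne_zero (hball (hsub hz)) hx)

lemma ConcentratedOn.tendsto_integral {μ : Measure ℝ} {K : Set ℝ}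
    (hμ : ConcentratedOn μ K) (hK : IsCompact K) :
    Tendsto (fun z : ℂ => ∫ x, (z - (x : ℂ))⁻¹ ∂μ) (cocompact ℂ) (nhds 0) := by
  have := hμ.finite
  have hcg : (cocompact ℂ).IsCountablyGenerated := by
    rw [← Metric.cobounded_eq_cocompact, ← comap_norm_atTop]
    infer_instance
  obtain ⟨R, hR⟩ := hK.isBounded.exists_norm_le
  have hfar : ∀ᶠ z : ℂ in cocompact ℂ, R + 1 ≤ ‖z‖ :=
    (tendsto_norm_cocompact_atTop (E := ℂ)).eventually_ge_atTop _
  have hbd : ∀ z : ℂ, R + 1 ≤ ‖z‖ → ∀ x ∈ K, 1 ≤ ‖z - (x : ℂ)‖ := by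
    intro z hz x hx
    have h1 := norm_sub_norm_le z (x : ℂ)
    have h2 := hR x hx
    rw [Complex.norm_real] at h1
    linarith
  have h := tendsto_integral_filter_of_dominated_convergence (μ := μ) (l := cocompact ℂ)
    (F := fun (z : ℂ) (x : ℝ) => (z - (x : ℂ))⁻¹) (f := fun _ => 0) (fun _ => 1) ?_ ?_
    (integrable_const _) ?_
  · simpa using h
  · filter_upwards [hfar] with z hz
    refine (hμ.integrable hK (continuousOn_inv_sub ?_)).aestronglyMeasurable
    rintro ⟨x, hx, rfl⟩
    have := hbd _ hz x hx
    norm_num at this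
  · filter_upwards [hfar] with z hz
    filter_upwards [hμ.ae_mem] with x hx
    rw [norm_inv]
    exact inv_le_one_of_one_le₀ (hbd z hz x hx)
  · refine .of_forall fun x => ?_
    refine tendsto_inv₀_cobounded.comp ?_
    rw [← Metric.cobounded_eq_cocompact]
    exact tendsto_sub_const_cobounded _

namespace SignedM

/-- Both parts of the signed measure are finite and do not charge the complement of `K`. -/
structure ConcentratedOn (s : SignedM) (K : Set ℝ) : Prop where
  pos : _root_.ConcentratedOn s.pos K
  neg : _root_.ConcentratedOn s.neg K

lemma ofReal_cauchyR (s : SignedM) (x : ℝ) : (s.cauchyR x : ℂ) = s.cauchy x := by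
  simp only [cauchyR, rintegral, cauchy, cintegral, Complex.ofReal_sub, ← integral_complex_ofReal,
    Complex.ofReal_inv]

namespace ConcentratedOn

variable {s t : SignedM} {K L : Set ℝ}

lemma mono (hs : s.ConcentratedOn K) (h : K ⊆ L) : s.ConcentratedOn L :=
  ⟨hs.pos.mono h, hs.neg.mono h⟩

lemma cintegral_congr (hs : s.ConcentratedOn K) {f g : ℝ → ℂ} (hfg : EqOn f g K) :
    s.cintegral f = s.cintegral g := by
  rw [cintegral, cintegral, hs.pos.integral_congr hfg, hs.neg.integral_congr hfg]

lemma cintegral_add (hs : s.ConcentratedOn K) (hK : IsCompact K) {f g : ℝ → ℂ}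
    (hf : ContinuousOn f K) (hg : ContinuousOn g K) :
    s.cintegral (fun x => f x + g x) = s.cintegral f + s.cintegral g := by
  rw [cintegral, cintegral, cintegral,
    integral_add (hs.pos.integrable hK hf) (hs.pos.integrable hK hg),
    integral_add (hs.neg.integrable hK hf) (hs.neg.integrable hK hg)]
  ring

lemma withDensityR (hs : s.ConcentratedOn K) (hK : IsCompact K) {g : ℝ → ℝ}
    (hg : ContinuousOn g K) : (s.withDensityR g).ConcentratedOn K :=
  ⟨(hs.pos.withDensity hK hg).add (hs.neg.withDensity hK hg.neg),
    (hs.pos.withDensity hK hg.neg).add (hs.neg.withDensity hK hg)⟩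

lemma cintegral_withDensityR (hs : s.ConcentratedOn K) (hK : IsCompact K) {g : ℝ → ℝ}
    (hg : ContinuousOn g K) {f : ℝ → ℂ} (hf : ContinuousOn f K) :
    (s.withDensityR g).cintegral f = s.cintegral fun x => (g x : ℂ) * f x := by
  have h₁ := hs.pos.integral_withDensity_sub hK hg hf
  have h₂ := hs.neg.integral_withDensity_sub hK hg hf
  rw [cintegral, cintegral, ← h₁, ← h₂]
  simp only [SignedM.withDensityR]
  rw [integral_add_measure, integral_add_measure]
  · ring
  · exact (hs.pos.withDensity hK hg.neg).integrable hK hf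
  · exact (hs.neg.withDensity hK hg).integrable hK hf
  · exact (hs.pos.withDensity hK hg).integrable hK hf
  · exact (hs.neg.withDensity hK hg.neg).integrable hK hf

lemma cauchy_withDensityR (hs : s.ConcentratedOn K) (hK : IsCompact K) {g : ℝ → ℝ}
    (hg : ContinuousOn g K) {z : ℂ} (hz : z ∉ cSet K) :
    (s.withDensityR g).cauchy z = s.cintegral fun x => (g x : ℂ) * (z - (x : ℂ))⁻¹ :=
  hs.cintegral_withDensityR hK hg (continuousOn_inv_sub hz)

lemma cauchy_withDensityR_withDensityR (hs : s.ConcentratedOn K) (hK : IsCompact K)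
    {g h k : ℝ → ℝ} (hg : ContinuousOn g K) (hh : ContinuousOn h K)
    (hk : ∀ x ∈ K, k x = h x * g x) {z : ℂ} (hz : z ∉ cSet K) :
    ((s.withDensityR g).withDensityR h).cauchy z = (s.withDensityR k).cauchy z := by
  have hk' : ContinuousOn k K := (hh.mul hg).congr hk
  have hc := continuousOn_inv_sub hz
  rw [(hs.withDensityR hK hg).cauchy_withDensityR hK hh hz,
    hs.cintegral_withDensityR hK hg (by fun_prop), hs.cauchy_withDensityR hK hk' hz]
  refine hs.cintegral_congr fun x hx => ?_
  simp only [hk x hx]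
  push_cast
  ring

lemma cintegral_swap (hs : s.ConcentratedOn K) (ht : t.ConcentratedOn L)
    (hK : IsCompact K) (hL : IsCompact L) {F : ℝ → ℝ → ℂ}
    (hF : ContinuousOn (Function.uncurry F) (K ×ˢ L)) :
    (s.cintegral fun x => t.cintegral fun y => F x y) =
      t.cintegral fun y => s.cintegral fun x => F x y := by
  have hF' : ContinuousOn (Function.uncurry fun y x => F x y) (L ×ˢ K) :=
    hF.comp continuous_swap.continuousOn fun p hp => ⟨hp.2, hp.1⟩
  have hint {μ ν : Measure ℝ} (hμ : _root_.ConcentratedOn μ K) (hν : _root_.ConcentratedOn ν L) :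
      Integrable (fun x => ∫ y, F x y ∂ν) μ := by
    have := hμ.finite
    have := hν.finite
    have h := hF.integrableOn_compact (μ := μ.prod ν) (hK.prod hL)
    rw [IntegrableOn, ← Measure.prod_restrict, hμ.restrict_eq, hν.restrict_eq] at h
    exact h.integral_prod_left
  have hint' {μ ν : Measure ℝ} (hμ : _root_.ConcentratedOn μ K) (hν : _root_.ConcentratedOn ν L) :
      Integrable (fun y => ∫ x, F x y ∂μ) ν := by
    have := hμ.finite
    have := hν.finite
    have h := hF'.integrableOn_compact (μ := ν.prod μ) (hL.prod hK)
    rw [IntegrableOn, ← Measure.prod_restrict, hμ.restrict_eq, hν.restrict_eq] at h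
    exact h.integral_prod_left
  simp only [cintegral]
  rw [integral_sub (hint hs.pos ht.pos) (hint hs.pos ht.neg),
    integral_sub (hint hs.neg ht.pos) (hint hs.neg ht.neg),
    integral_sub (hint' hs.pos ht.pos) (hint' hs.neg ht.pos),
    integral_sub (hint' hs.pos ht.neg) (hint' hs.neg ht.neg),
    hs.pos.integral_swap ht.pos hK hL hF, hs.pos.integral_swap ht.neg hK hL hF,
    hs.neg.integral_swap ht.pos hK hL hF, hs.neg.integral_swap ht.neg hK hL hF]
  ring

lemma differentiableOn_cauchy (hs : s.ConcentratedOn K) (hK : IsCompact K) :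
    DifferentiableOn ℂ s.cauchy (cSet K)ᶜ :=
  (hs.pos.differentiableOn_integral hK).sub (hs.neg.differentiableOn_integral hK)

lemma tendsto_cauchy (hs : s.ConcentratedOn K) (hK : IsCompact K) :
    Tendsto s.cauchy (cocompact ℂ) (nhds 0) := by
  have h := (hs.pos.tendsto_integral hK).sub (hs.neg.tendsto_integral hK)
  rwa [sub_zero] at h

lemma continuousOn_cauchyR (hs : s.ConcentratedOn K) (hK : IsCompact K) (hd : Disjoint L K) :
    ContinuousOn s.cauchyR L := by
  have h : ContinuousOn (fun x : ℝ => (s.cauchy x).re) L :=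
    Complex.continuous_re.comp_continuousOn
      ((hs.differentiableOn_cauchy hK).continuousOn.comp Complex.continuous_ofReal.continuousOn
        fun x hx => fun h => disjoint_left.1 hd hx (mem_cSet_ofReal.1 h))
  exact h.congr fun x _ => by simp [← ofReal_cauchyR]

lemma nik (hs : s.ConcentratedOn K) (ht : t.ConcentratedOn L) (hK : IsCompact K)
    (hL : IsCompact L) (hd : Disjoint K L) : (s.nik t).ConcentratedOn K :=
  hs.withDensityR hK (ht.continuousOn_cauchyR hL hd)

lemma cauchy_nik (hs : s.ConcentratedOn K) (ht : t.ConcentratedOn L) (hK : IsCompact K)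
    (hL : IsCompact L) (hd : Disjoint K L) {z : ℂ} (hz : z ∉ cSet K) :
    (s.nik t).cauchy z = s.cintegral fun x => t.cauchy x * (z - (x : ℂ))⁻¹ := by
  rw [SignedM.nik, hs.cauchy_withDensityR hK (ht.continuousOn_cauchyR hL hd) hz]
  simp only [ofReal_cauchyR]

lemma cintegral_mul_left (s : SignedM) (c : ℂ) (f : ℝ → ℂ) :
    (s.cintegral fun x => c * f x) = c * s.cintegral f := by
  simp only [cintegral, integral_const_mul, mul_sub]

lemma cintegral_mul_right (s : SignedM) (c : ℂ) (f : ℝ → ℂ) :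
    (s.cintegral fun x => f x * c) = s.cintegral f * c := by
  simp only [cintegral, integral_mul_const, sub_mul]

/-- The product of two Cauchy transforms: `ŝ t̂ = ⟨s, t⟩^ + ⟨t, s⟩^`. -/
lemma cauchy_mul_cauchy (hs : s.ConcentratedOn K) (ht : t.ConcentratedOn L) (hK : IsCompact K)
    (hL : IsCompact L) (hd : Disjoint K L) {z : ℂ} (hzK : z ∉ cSet K) (hzL : z ∉ cSet L) :
    s.cauchy z * t.cauchy z = (s.nik t).cauchy z + (t.nik s).cauchy z := by
  have hne : ∀ x ∈ K, ∀ y ∈ L, (x : ℂ) - y ≠ 0 := fun x hx y hy h =>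
    disjoint_left.1 hd hx (by rwa [Complex.ofReal_injective (sub_eq_zero.1 h)])
  have hF : ContinuousOn (Function.uncurry fun x y : ℝ =>
      ((y : ℂ) - x)⁻¹ * (z - (y : ℂ))⁻¹) (K ×ˢ L) := by
    refine ContinuousOn.mul (ContinuousOn.inv₀ (by fun_prop) ?_)
      (ContinuousOn.inv₀ (by fun_prop) fun p hp => sub_ofReal_ne_zero hzL hp.2)
    intro p hp
    rw [← neg_ne_zero, neg_sub]
    exact hne _ hp.1 _ hp.2
  have h₂ : (t.nik s).cauchy z =
      s.cintegral fun x => t.cintegral fun y => ((y : ℂ) - x)⁻¹ * (z - (y : ℂ))⁻¹ := by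
    rw [ht.cauchy_nik hs hL hK hd.symm hzL, hs.cintegral_swap ht hK hL hF]
    simp only [cintegral_mul_right]
    rfl
  have hc := continuousOn_inv_sub hzK
  have hcy := continuousOn_inv_sub hzL
  have h₃ : ∀ x ∈ K, (z - (x : ℂ))⁻¹ * t.cauchy z =
      t.cauchy x * (z - (x : ℂ))⁻¹ +
        t.cintegral fun y => ((y : ℂ) - x)⁻¹ * (z - (y : ℂ))⁻¹ := by
    intro x hx
    have hxL : (x : ℂ) ∉ cSet L := fun h => disjoint_left.1 hd hx (mem_cSet_ofReal.1 h)
    have hcx := continuousOn_inv_sub hxL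
    have hcx' : ContinuousOn (fun y : ℝ => ((y : ℂ) - x)⁻¹) L :=
      hcx.neg.congr fun y _ => by rw [Pi.neg_apply, ← inv_neg, neg_sub]
    rw [cauchy, cauchy, ← cintegral_mul_left, ← cintegral_mul_right,
      ← ht.cintegral_add hL (by fun_prop) (by fun_prop)]
    refine ht.cintegral_congr fun y hy => ?_
    have h1 := hne x hx y hy
    have h2 : (y : ℂ) - x ≠ 0 := by rwa [← neg_ne_zero, neg_sub]
    have h3 := sub_ofReal_ne_zero hzK hx
    have h4 := sub_ofReal_ne_zero hzL hy
    have h5 : ((y : ℂ) - x)⁻¹ = -((x : ℂ) - y)⁻¹ := by rw [← inv_neg, neg_sub]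
    simp only [h5]
    field_simp
    ring
  have hct : ContinuousOn (fun x : ℝ => t.cauchy x) K := by
    simp only [← ofReal_cauchyR]
    exact Complex.continuous_ofReal.comp_continuousOn (ht.continuousOn_cauchyR hL hd)
  have hc₁ : ContinuousOn (fun x : ℝ => t.cauchy x * (z - (x : ℂ))⁻¹) K := hct.mul hc
  rw [h₂, hs.cauchy_nik ht hK hL hd hzK, ← hs.cintegral_add hK hc₁, ← hs.cintegral_congr h₃,
    cintegral_mul_right, cauchy]
  exact ((hc.mul continuousOn_const).sub hc₁).congr fun x hx =>
    eq_sub_of_add_eq' (h₃ x hx).symm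

/-- `z ŝ(z)` has a finite limit at infinity. -/
lemma exists_tendsto_mul_cauchy (hs : s.ConcentratedOn K) (hK : IsCompact K) :
    ∃ c, Tendsto (fun z => z * s.cauchy z) (cocompact ℂ) (nhds c) := by
  have h := (hs.withDensityR hK (g := id) continuousOn_id).tendsto_cauchy hK
  refine ⟨s.cintegral (fun _ => 1) + 0, (tendsto_const_nhds.add h).congr' ?_⟩
  have hev : ∀ᶠ z in cocompact ℂ, z ∉ cSet K :=
    (hK.image Complex.continuous_ofReal).compl_mem_cocompact
  filter_upwards [hev] with z hz
  have hc := continuousOn_inv_sub hz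
  rw [hs.cauchy_withDensityR hK continuousOn_id hz,
    ← hs.cintegral_add hK (by fun_prop) (by simp only [id]; fun_prop), cauchy,
    ← cintegral_mul_left]
  refine hs.cintegral_congr fun x hx => ?_
  have := sub_ofReal_ne_zero hz hx
  simp only [id]
  field_simp
  ring

end ConcentratedOn

end SignedM

namespace SignedM

/-- `s` has a nowhere vanishing continuous density on `K` with respect to a nonzero positive
measure. -/
def NonvanishingOn (s : SignedM) (K : Set ℝ) : Prop :=
  ∃ (μ : Measure ℝ) (w : ℝ → ℝ), _root_.ConcentratedOn μ K ∧ μ ≠ 0 ∧ ContinuousOn w K ∧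
    (∀ x ∈ K, w x ≠ 0) ∧
    ∀ f : ℝ → ℂ, ContinuousOn f K → s.cintegral f = ∫ x, (w x : ℂ) * f x ∂μ

namespace NonvanishingOn

variable {s : SignedM} {K : Set ℝ}

lemma withDensityR (h : s.NonvanishingOn K) (hs : s.ConcentratedOn K) (hK : IsCompact K)
    {g : ℝ → ℝ} (hg : ContinuousOn g K) (hne : ∀ x ∈ K, g x ≠ 0) :
    (s.withDensityR g).NonvanishingOn K := by
  obtain ⟨μ, w, hμ, h0, hw, hw0, hrep⟩ := h
  refine ⟨μ, fun x => w x * g x, hμ, h0, hw.mul hg,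
    fun x hx => mul_ne_zero (hw0 x hx) (hne x hx), fun f hf => ?_⟩
  rw [hs.cintegral_withDensityR hK hg hf, hrep _ (by fun_prop)]
  simp only [Complex.ofReal_mul, mul_assoc]

lemma cauchy_ne_zero (h : s.NonvanishingOn K) (hK : IsCompact K) (hK' : IsPreconnected K)
    {z : ℂ} (hz : z ∉ cSet K) : s.cauchy z ≠ 0 := by
  obtain ⟨μ, w, hμ, h0, hw, hw0, hrep⟩ := h
  have hc := continuousOn_inv_sub hz
  have hcont : ContinuousOn (fun x : ℝ => (w x : ℂ) * (z - (x : ℂ))⁻¹) K := by fun_prop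
  have key : ∀ l : ℂ →L[ℝ] ℝ, (∀ x ∈ K, l ((w x : ℂ) * (z - (x : ℂ))⁻¹) ≠ 0) →
      s.cauchy z ≠ 0 := by
    intro l hl hzero
    refine hμ.integral_ne_zero hK hK' h0 (l.continuous.comp_continuousOn hcont) hl ?_
    have := l.integral_comp_comm (hμ.integrable hK hcont)
    simp only [Function.comp_apply]
    rw [this, ← hrep _ hc, ← cauchy, hzero, map_zero]
  by_cases him : z.im = 0
  · refine key Complex.reCLM fun x hx => ?_
    have hne := sub_ofReal_ne_zero hz hx
    have hre : z.re - x ≠ 0 := fun h => hne (by apply Complex.ext <;> simp [h, him])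
    simp only [Complex.reCLM_apply, Complex.re_ofReal_mul, Complex.inv_re]
    exact mul_ne_zero (hw0 x hx) (div_ne_zero (by simpa using hre)
      (Complex.normSq_pos.2 hne).ne')
  · refine key Complex.imCLM fun x hx => ?_
    have hne := sub_ofReal_ne_zero hz hx
    simp only [Complex.imCLM_apply, Complex.im_ofReal_mul, Complex.inv_im]
    exact mul_ne_zero (hw0 x hx) (div_ne_zero (by simpa using him)
      (Complex.normSq_pos.2 hne).ne')

lemma cauchyR_ne_zero (h : s.NonvanishingOn K) (hK : IsCompact K) (hK' : IsPreconnected K)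
    {x : ℝ} (hx : x ∉ K) : s.cauchyR x ≠ 0 := by
  rw [← Complex.ofReal_ne_zero, ofReal_cauchyR]
  exact h.cauchy_ne_zero hK hK' (mt mem_cSet_ofReal.1 hx)

lemma nik {t : SignedM} {L : Set ℝ} (hs : s.NonvanishingOn K) (ht : t.NonvanishingOn L)
    (hsK : s.ConcentratedOn K) (htL : t.ConcentratedOn L) (hK : IsCompact K) (hL : IsCompact L)
    (hL' : IsPreconnected L) (hd : Disjoint K L) : (s.nik t).NonvanishingOn K :=
  hs.withDensityR hsK hK (htL.continuousOn_cauchyR hL hd) fun _ hx =>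
    ht.cauchyR_ne_zero hL hL' (disjoint_left.1 hd hx)

end NonvanishingOn

end SignedM

namespace IsM

variable {s : SignedM} {K : Set ℝ}

lemma isCompact (hs : IsM s K) : IsCompact K := hs.hullEq ▸ isCompact_Icc

lemma isPreconnected (hs : IsM s K) : IsPreconnected K := hs.hullEq ▸ isPreconnected_Icc

lemma supp_subset (hs : IsM s K) : s.supp ⊆ K := fun _ hx => by
  rw [hs.hullEq]
  exact ⟨csInf_le hs.compactSupp.bddBelow hx, le_csSup hs.compactSupp.bddAbove hx⟩

lemma concentratedOn (hs : IsM s K) : s.ConcentratedOn K := by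
  have key : ∀ μ : Measure ℝ, SignedM.msupport μ ⊆ K → μ Kᶜ = 0 := by
    intro μ hμ
    refine measure_null_of_locally_null _ fun x hx => ?_
    have hx' : x ∉ SignedM.msupport μ := fun h => hx (hμ h)
    simp only [SignedM.msupport, mem_ofPred_eq, not_forall, not_not] at hx'
    obtain ⟨U, hU, hxU, h0⟩ := hx'
    exact ⟨U, mem_nhdsWithin_of_mem_nhds (hU.mem_nhds hxU), h0⟩
  exact ⟨⟨hs.posFinite, key _ (subset_union_left.trans hs.supp_subset)⟩,
    ⟨hs.negFinite, key _ (subset_union_right.trans hs.supp_subset)⟩⟩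

lemma nonvanishingOn (hs : IsM s K) : s.NonvanishingOn K := by
  obtain ⟨x, hx⟩ := hs.infiniteSupp.nonempty
  have key : SignedM.msupport (0 : Measure ℝ) = ∅ := by
    ext y
    simp only [SignedM.msupport, mem_ofPred_eq, mem_empty_iff_false, iff_false]
    exact fun h => h univ isOpen_univ (mem_univ y) (by simp)
  rcases hs.constSign with h | h
  · refine ⟨s.neg, fun _ => -1, hs.concentratedOn.neg, fun h0 => ?_, continuousOn_const,
      fun _ _ => by norm_num, fun f _ => ?_⟩
    · simp [SignedM.supp, h, h0, key] at hx
    · simp [SignedM.cintegral, h, integral_neg]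
  · refine ⟨s.pos, fun _ => 1, hs.concentratedOn.pos, fun h0 => ?_, continuousOn_const,
      fun _ _ => by norm_num, fun f _ => ?_⟩
    · simp [SignedM.supp, h, h0, key] at hx
    · simp [SignedM.cintegral, h]

end IsM

/-- `H` is holomorphic off `L`, and for every `τ` on `K` the Cauchy transform of `h·τ` differs
from `H·τ̂` by a function which is holomorphic off `L`. -/
structure IsCauchyMultiplier (K L : Set ℝ) (h : ℝ → ℝ) (H : ℂ → ℂ) : Prop where
  differentiableOn : DifferentiableOn ℂ H (cSet L)ᶜ
  continuousOn : ContinuousOn h K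
  exists_remainder : ∀ τ : SignedM, τ.ConcentratedOn K → ∃ E : ℂ → ℂ,
    DifferentiableOn ℂ E (cSet L)ᶜ ∧ ∀ z, z ∉ cSet K → z ∉ cSet L →
      (τ.withDensityR h).cauchy z = H z * τ.cauchy z + E z

namespace IsCauchyMultiplier

variable {K L : Set ℝ} {ν : SignedM} {g h : ℝ → ℝ} {G H : ℂ → ℂ}

lemma mul (hg : IsCauchyMultiplier K L g G) (hh : IsCauchyMultiplier K L h H)
    (hK : IsCompact K) :
    IsCauchyMultiplier K L (fun x => g x * h x) (fun z => G z * H z) := by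
  refine ⟨hg.differentiableOn.mul hh.differentiableOn, hg.continuousOn.mul hh.continuousOn,
    fun τ hτ => ?_⟩
  obtain ⟨E, hE, hEz⟩ := hh.exists_remainder τ hτ
  obtain ⟨E', hE', hEz'⟩ := hg.exists_remainder _ (hτ.withDensityR hK hh.continuousOn)
  refine ⟨fun z => G z * E z + E' z, (hg.differentiableOn.mul hE).add hE', fun z hzK hzL => ?_⟩
  rw [← hτ.cauchy_withDensityR_withDensityR hK hh.continuousOn hg.continuousOn
    (fun _ _ => rfl) hzK, hEz' z hzK hzL, hEz z hzK hzL]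
  ring

lemma cauchy (hν : ν.ConcentratedOn L) (hK : IsCompact K) (hL : IsCompact L)
    (hd : Disjoint K L) : IsCauchyMultiplier K L ν.cauchyR ν.cauchy := by
  refine ⟨hν.differentiableOn_cauchy hL, hν.continuousOn_cauchyR hL hd, fun τ hτ =>
    ⟨fun z => -(ν.nik τ).cauchy z,
      ((hν.nik hτ hL hK hd.symm).differentiableOn_cauchy hL).neg, fun z hzK hzL => ?_⟩⟩
  have := hτ.cauchy_mul_cauchy hν hK hL hd hzK hzL
  rw [← SignedM.nik]
  linear_combination -this

lemma inv_cauchy (hν : ν.ConcentratedOn L) (hK : IsCompact K) (hL : IsCompact L)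
    (hd : Disjoint K L) (hne : ∀ z, z ∉ cSet L → ν.cauchy z ≠ 0) :
    IsCauchyMultiplier K L (fun x => (ν.cauchyR x)⁻¹) (fun z => (ν.cauchy z)⁻¹) := by
  have hneR : ∀ x ∈ K, ν.cauchyR x ≠ 0 := by
    intro x hx
    rw [← Complex.ofReal_ne_zero, SignedM.ofReal_cauchyR]
    exact hne _ fun h => disjoint_left.1 hd hx (mem_cSet_ofReal.1 h)
  have hcont := hν.continuousOn_cauchyR hL hd
  have hcinv : ContinuousOn (fun x => (ν.cauchyR x)⁻¹) K := hcont.inv₀ hneR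
  have hdinv : DifferentiableOn ℂ (fun z => (ν.cauchy z)⁻¹) (cSet L)ᶜ :=
    (hν.differentiableOn_cauchy hL).inv hne
  refine ⟨hdinv, hcinv, fun τ hτ => ?_⟩
  have hτ' := hτ.withDensityR hK hcinv
  refine ⟨fun z => (ν.cauchy z)⁻¹ * (ν.nik (τ.withDensityR fun x => (ν.cauchyR x)⁻¹)).cauchy z,
    hdinv.mul ((hν.nik hτ' hL hK hd.symm).differentiableOn_cauchy hL), fun z hzK hzL => ?_⟩
  have h₁ := hτ'.cauchy_mul_cauchy hν hK hL hd hzK hzL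
  have h₂ : ((τ.withDensityR fun x => (ν.cauchyR x)⁻¹).nik ν).cauchy z = τ.cauchy z := by
    rw [SignedM.nik, hτ.cauchy_withDensityR_withDensityR hK hcinv hcont
      (k := fun _ => 1) (fun x hx => (mul_inv_cancel₀ (hneR x hx)).symm) hzK,
      hτ.cauchy_withDensityR hK continuousOn_const hzK]
    simp [SignedM.cauchy]
  rw [h₂] at h₁
  rw [← mul_add, ← h₁, mul_comm _ (ν.cauchy z), inv_mul_cancel_left₀ (hne z hzL)]

end IsCauchyMultiplier

lemma eq_zero_of_eqOn_of_tendsto {K L : Set ℝ} (hK : IsCompact K) (hL : IsCompact L)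
    (hd : Disjoint K L) {F E : ℂ → ℂ} (hF : DifferentiableOn ℂ F (cSet K)ᶜ)
    (hE : DifferentiableOn ℂ E (cSet L)ᶜ) (hFE : ∀ z, z ∉ cSet K → z ∉ cSet L → F z = E z)
    (hlim : Tendsto F (cocompact ℂ) (nhds 0)) {z : ℂ} (hz : z ∉ cSet K) : F z = 0 := by
  classical
  have hev : ∀ᶠ z in cocompact ℂ, z ∉ cSet K :=
    (hK.image Complex.continuous_ofReal).compl_mem_cocompact
  let f : ℂ → ℂ := fun z => if z ∈ cSet K then E z else F z
  have hf : Differentiable ℂ f := by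
    intro w
    by_cases hw : w ∈ cSet K
    · have hwL : w ∈ (cSet L)ᶜ := by
        obtain ⟨x, hx, rfl⟩ := hw
        exact fun h => disjoint_left.1 hd hx (mem_cSet_ofReal.1 h)
      have hn := (isOpen_compl_cSet hL).mem_nhds hwL
      refine (hE.differentiableAt hn).congr_of_eventuallyEq ?_
      filter_upwards [hn] with y hy
      by_cases hyK : y ∈ cSet K
      · simp [f, hyK]
      · simpa [f, hyK] using hFE y hyK hy
    · have hn := (isOpen_compl_cSet hK).mem_nhds hw
      refine (hF.differentiableAt hn).congr_of_eventuallyEq ?_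
      filter_upwards [hn] with y hy
      exact if_neg hy
  have hlim' : Tendsto f (cocompact ℂ) (nhds 0) :=
    hlim.congr' (hev.mono fun y hy => (if_neg hy).symm)
  simpa [f, hz] using hf.apply_eq_of_tendsto_cocompact z hlim'

/-- The quotient of Cauchy transforms `r̂ t̂ / ŝ` tends to zero at infinity if `ŝ` has an inverse
measure. -/
lemma IsInverse.tendsto_mul_div {r t s τ : SignedM} {K : Set ℝ} (hK : IsCompact K)
    (hτ : IsInverse s τ K) (hτK : τ.ConcentratedOn K) (hr : r.ConcentratedOn K)
    (ht : t.ConcentratedOn K) :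
    Tendsto (fun z => r.cauchy z * t.cauchy z / s.cauchy z) (cocompact ℂ) (nhds 0) := by
  obtain ⟨b, hb⟩ := hτ
  obtain ⟨c, hc⟩ := hr.exists_tendsto_mul_cauchy hK
  have hr0 := hr.tendsto_cauchy hK
  have ht0 := ht.tendsto_cauchy hK
  have h := ((hc.mul ht0).mul_const (s.mass : ℂ)⁻¹).add
    ((hr0.mul ht0).mul ((hτK.tendsto_cauchy hK).const_add (b : ℂ)))
  simp only [mul_zero, zero_mul, add_zero] at h
  have hev : ∀ᶠ z in cocompact ℂ, z ∉ cSet K :=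
    (hK.image Complex.continuous_ofReal).compl_mem_cocompact
  refine h.congr' ?_
  filter_upwards [hev] with z hz
  rw [div_eq_mul_inv (_ * _), hb z hz]
  ring

/-- Formula (2.7) ("shirenu"): for every `z ∈ ℂ ∖ Δ_α`,
`(⟨σ_α,σ_β⟩^/⟨⟨σ_α,σ_β⟩,σ_γ⟩^)(z) · ⟨(⟨σ_β,σ_α⟩^/σ̂_β) τ_{α,β}, σ_γ, σ_α, σ_β⟩^(z) = Ĥ(z)`,
where `H` has density `(⟨σ_β,σ_α,σ_γ⟩^/σ̂_β)·(⟨σ_γ,σ_α,σ_β⟩^/σ̂_γ)` w.r.t. `τ_{α,β;γ,γ}`. -/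
theorem stmt19
    (Δa Δb Δg : Set ℝ) (σa σb σg : SignedM)
    (ha : IsM σa Δa) (hb : IsM σb Δb) (hg : IsM σg Δg)
    (hga : Δg ∩ Δa = ∅) (hba : Δb ∩ Δa = ∅)
    (τab : SignedM) (hτabM : IsM τab Δa) (hτab : IsInverse (σa.nik σb) τab Δa)
    (τabgg : SignedM) (hτabggM : IsM τabgg Δa)
    (hτabgg : IsInverse ((σa.nik σb).nik σg) τabgg Δa) :
    ∀ z : ℂ, z ∉ cSet Δa →
      (σa.nik σb).cauchy z / ((σa.nik σb).nik σg).cauchy z *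
          ((τab.withDensityR fun x => (σb.nik σa).cauchyR x / σb.cauchyR x).nik
            (σg.nik (σa.nik σb))).cauchy z =
        (τabgg.withDensityR fun x =>
          ((σb.nik (σa.nik σg)).cauchyR x / σb.cauchyR x) *
            ((σg.nik (σa.nik σb)).cauchyR x / σg.cauchyR x)).cauchy z := by
  have hKa := ha.isCompact
  have hKb := hb.isCompact
  have hKg := hg.isCompact
  have hL : IsCompact (Δb ∪ Δg) := hKb.union hKg
  have dab : Disjoint Δa Δb := (disjoint_iff_inter_eq_empty.2 hba).symm
  have dag : Disjoint Δa Δg := (disjoint_iff_inter_eq_empty.2 hga).symm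
  have dL : Disjoint Δa (Δb ∪ Δg) := dab.union_right dag
  have hLb : ∀ z, z ∉ cSet (Δb ∪ Δg) → z ∉ cSet Δb := fun z hz h =>
    hz (cSet_mono subset_union_left h)
  have hLg : ∀ z, z ∉ cSet (Δb ∪ Δg) → z ∉ cSet Δg := fun z hz h =>
    hz (cSet_mono subset_union_right h)
  have ca := ha.concentratedOn
  have cb := hb.concentratedOn
  have cg := hg.concentratedOn
  have cab := ca.nik cb hKa hKb dab
  have cag := ca.nik cg hKa hKg dag
  have cabg := cab.nik cg hKa hKg dag
  have cba := cb.nik ca hKb hKa dab.symm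
  have cga := cg.nik ca hKg hKa dag.symm
  have cbag := cb.nik cag hKb hKa dab.symm
  have cgab := cg.nik cab hKg hKa dag.symm
  have nab := ha.nonvanishingOn.nik hb.nonvanishingOn ca cb hKa hKb hb.isPreconnected dab
  have nabg := nab.nik hg.nonvanishingOn cab cg hKa hKg hg.isPreconnected dag
  have neab : ∀ z, z ∉ cSet Δa → (σa.nik σb).cauchy z ≠ 0 := fun z hz =>
    nab.cauchy_ne_zero hKa ha.isPreconnected hz
  have neabg : ∀ z, z ∉ cSet Δa → ((σa.nik σb).nik σg).cauchy z ≠ 0 := fun z hz =>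
    nabg.cauchy_ne_zero hKa ha.isPreconnected hz
  have neb : ∀ z, z ∉ cSet (Δb ∪ Δg) → σb.cauchy z ≠ 0 := fun z hz =>
    hb.nonvanishingOn.cauchy_ne_zero hKb hb.isPreconnected (hLb z hz)
  have neg : ∀ z, z ∉ cSet (Δb ∪ Δg) → σg.cauchy z ≠ 0 := fun z hz =>
    hg.nonvanishingOn.cauchy_ne_zero hKg hg.isPreconnected (hLg z hz)
  have sb : Δb ⊆ Δb ∪ Δg := subset_union_left
  have sg : Δg ⊆ Δb ∪ Δg := subset_union_right
  have mb := IsCauchyMultiplier.inv_cauchy (cb.mono sb) hKa hL dL neb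
  have mg := IsCauchyMultiplier.inv_cauchy (cg.mono sg) hKa hL dL neg
  have mba := (IsCauchyMultiplier.cauchy (cba.mono sb) hKa hL dL).mul mb hKa
  have mgab := IsCauchyMultiplier.cauchy (cgab.mono sg) hKa hL dL
  have mbag := (IsCauchyMultiplier.cauchy (cbag.mono sb) hKa hL dL).mul mb hKa
  have cτ := hτabM.concentratedOn
  have cτ' := hτabggM.concentratedOn
  have da := ca.differentiableOn_cauchy hKa
  have dab' := cab.differentiableOn_cauchy hKa
  have dag' := cag.differentiableOn_cauchy hKa
  have dabg := cabg.differentiableOn_cauchy hKa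
  have dga := (cga.mono sg).differentiableOn_cauchy hL
  have hM : ∀ z, z ∉ cSet Δa → ((σa.nik σg).nik σb).cauchy z =
      ((σa.nik σb).nik σg).cauchy z := fun z hz => by
    have h₁ := cb.continuousOn_cauchyR hKb dab
    have h₂ := cg.continuousOn_cauchyR hKg dag
    rw [SignedM.nik, SignedM.nik, SignedM.nik, SignedM.nik,
      ca.cauchy_withDensityR_withDensityR hKa h₁ h₂ (fun _ _ => mul_comm _ _) hz,
      ca.cauchy_withDensityR_withDensityR hKa h₂ h₁ (fun _ _ => rfl) hz]
  have left : ∀ z, z ∉ cSet Δa →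
      ((τab.withDensityR fun x => (σb.nik σa).cauchyR x / σb.cauchyR x).nik
          (σg.nik (σa.nik σb))).cauchy z =
        (σa.nik σg).cauchy z -
          σa.cauchy z * ((σa.nik σb).nik σg).cauchy z / (σa.nik σb).cauchy z := by
    intro z hz
    have cp := cτ.withDensityR hKa mba.continuousOn
    have cpq := cp.withDensityR hKa mgab.continuousOn
    obtain ⟨E, hE, hEz⟩ := (mgab.mul mba hKa).exists_remainder τab cτ
    have hlim := ((cpq.tendsto_cauchy hKa).sub (cag.tendsto_cauchy hKa)).add
      (hτab.tendsto_mul_div hKa cτ ca cabg)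
    obtain ⟨b, hinv⟩ := hτab
    simp only [sub_zero, add_zero] at hlim
    have h := eq_zero_of_eqOn_of_tendsto hKa hL dL
      (E := fun w => E w + (σg.nik σa).cauchy w -
        (σg.nik (σa.nik σb)).cauchy w * (σb.cauchy w)⁻¹ -
        (σg.nik (σa.nik σb)).cauchy w * ((σb.nik σa).cauchy w * (σb.cauchy w)⁻¹) *
          (w * ((σa.nik σb).mass : ℂ)⁻¹ + b))
      (((cpq.differentiableOn_cauchy hKa).sub dag').add ((da.mul dabg).div dab' neab))
      (((hE.add dga).sub (mgab.differentiableOn.mul mb.differentiableOn)).sub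
        ((mgab.mul mba hKa).differentiableOn.mul
          ((differentiableOn_id.mul_const _).add_const _))) ?_ hlim hz
    · simp only [Pi.add_apply, Pi.sub_apply, Pi.div_apply, Pi.mul_apply] at h
      simp only [SignedM.nik, div_eq_mul_inv] at h ⊢
      linear_combination h
    · intro w hwa hwL
      have e₁ := cτ.cauchy_withDensityR_withDensityR hKa mba.continuousOn mgab.continuousOn
        (fun _ _ => rfl) hwa
      have e₂ := hEz w hwa hwL
      have e₃ := hinv w hwa
      have e₄ := ca.cauchy_mul_cauchy cb hKa hKb dab hwa (hLb w hwL)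
      have e₅ := cab.cauchy_mul_cauchy cg hKa hKg dag hwa (hLg w hwL)
      have e₆ := ca.cauchy_mul_cauchy cg hKa hKg dag hwa (hLg w hwL)
      have n₁ := inv_mul_cancel₀ (neab w hwa)
      have n₂ := inv_mul_cancel₀ (neb w hwL)
      simp only [Pi.add_apply, Pi.sub_apply, Pi.div_apply, Pi.mul_apply]
      rw [e₁, e₂]
      simp only [div_eq_mul_inv] at e₃ ⊢
      set i := ((σa.nik σb).cauchy w)⁻¹
      set j := (σb.cauchy w)⁻¹
      set Q := (σg.nik (σa.nik σb)).cauchy w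
      linear_combination (-Q * (σb.nik σa).cauchy w * j) * e₃ - Q * j * i * e₄ +
        Q * i * σa.cauchy w * n₂ + (σa.cauchy w * σg.cauchy w - Q * j) * n₁ -
        σa.cauchy w * i * e₅ + e₆
  have right : ∀ z, z ∉ cSet Δa →
      (τabgg.withDensityR fun x =>
          ((σb.nik (σa.nik σg)).cauchyR x / σb.cauchyR x) *
            ((σg.nik (σa.nik σb)).cauchyR x / σg.cauchyR x)).cauchy z =
        (σa.nik σg).cauchy z * (σa.nik σb).cauchy z / ((σa.nik σb).nik σg).cauchy z -
          σa.cauchy z := by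
    intro z hz
    have mH := mbag.mul (mgab.mul mg hKa) hKa
    have cH := cτ'.withDensityR hKa mH.continuousOn
    obtain ⟨E, hE, hEz⟩ := mH.exists_remainder τabgg cτ'
    have hlim := ((cH.tendsto_cauchy hKa).sub
      (hτabgg.tendsto_mul_div hKa cτ' cag cab)).add (ca.tendsto_cauchy hKa)
    obtain ⟨b, hinv⟩ := hτabgg
    simp only [sub_zero, add_zero] at hlim
    have h := eq_zero_of_eqOn_of_tendsto hKa hL dL
      (E := fun w => E w + (σg.nik σa).cauchy w * (σg.cauchy w)⁻¹ -
        (σg.nik (σa.nik σb)).cauchy w * (σg.cauchy w)⁻¹ * (σb.cauchy w)⁻¹ -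
        (σb.nik (σa.nik σg)).cauchy w * (σb.cauchy w)⁻¹ *
          ((σg.nik (σa.nik σb)).cauchy w * (σg.cauchy w)⁻¹) *
          (w * (((σa.nik σb).nik σg).mass : ℂ)⁻¹ + b))
      (((cH.differentiableOn_cauchy hKa).sub ((dag'.mul dab').div dabg neabg)).add da)
      (((hE.add (dga.mul mg.differentiableOn)).sub
        ((mgab.mul mg hKa).differentiableOn.mul mb.differentiableOn)).sub
        (mH.differentiableOn.mul ((differentiableOn_id.mul_const _).add_const _))) ?_ hlim hz
    · simp only [Pi.add_apply, Pi.sub_apply, Pi.div_apply, Pi.mul_apply] at h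
      simp only [div_eq_mul_inv] at h ⊢
      linear_combination h
    · intro w hwa hwL
      have e₂ := hEz w hwa hwL
      have e₃ := hinv w hwa
      have e₅ := cab.cauchy_mul_cauchy cg hKa hKg dag hwa (hLg w hwL)
      have e₆ := ca.cauchy_mul_cauchy cg hKa hKg dag hwa (hLg w hwL)
      have e₇ := cag.cauchy_mul_cauchy cb hKa hKb dab hwa (hLb w hwL)
      rw [hM w hwa] at e₇
      have n₁ := inv_mul_cancel₀ (neabg w hwa)
      have n₂ := inv_mul_cancel₀ (neb w hwL)
      have n₃ := inv_mul_cancel₀ (neg w hwL)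
      simp only [Pi.add_apply, Pi.sub_apply, Pi.div_apply, Pi.mul_apply]
      rw [e₂]
      simp only [div_eq_mul_inv] at e₃ ⊢
      set k := (((σa.nik σb).nik σg).cauchy w)⁻¹
      set j := (σb.cauchy w)⁻¹
      set h := (σg.cauchy w)⁻¹
      set Q := (σg.nik (σa.nik σb)).cauchy w
      set ag := (σa.nik σg).cauchy w
      linear_combination (-(σb.nik (σa.nik σg)).cauchy w * j * Q * h) * e₃ -
        j * Q * h * k * e₇ + Q * h * k * ag * n₂ + (-j * Q * h - h * ag) * n₁ -
        h * k * ag * e₅ + (k * ag * (σa.nik σb).cauchy w - σa.cauchy w) * n₃ + h * e₆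
  intro z hz
  have n₁ := neab z hz
  have n₂ := neabg z hz
  rw [left z hz, right z hz]
  field_simp
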